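/- arXiv:1103.2062 — 3 statements merged into one kernel-verified Lean document; each statement's English description precedes it below -/
import Mathlib

section
/- Let X be a nonempty compact Hausdorff topological space and let φ be a flow on X. If for every natural number n the time-(1/2^n) map x ↦ φ(1/2^n, x) has a fixed point, then the flow has a stationary point, i.e. there exists x ∈ X such that φ(t, x) = x for all t ∈ ℝ. -/
namespace Flow

/-- The subgroup of periods of a point under a flow. -/
def periods {τ α : Type*} [TopologicalSpace τ] [TopologicalSpace α] [AddGroup τ]
    (φ : Flow τ α) (x : α) : AddSubgroup τ where
  carrier := {t | φ t x = x}
  zero_mem' := φ.map_zero_apply x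
  add_mem' {s t} (hs : φ s x = x) (ht : φ t x = x) := by
    rw [Set.mem_ofPred_eq, φ.map_add, ht, hs]
  neg_mem' {t} (ht : φ t x = x) := by
    rw [Set.mem_ofPred_eq]
    nth_rewrite 1 [← ht]
    rw [← φ.map_add, neg_add_cancel, φ.map_zero_apply]

theorem mem_periods {τ α : Type*} [TopologicalSpace τ] [TopologicalSpace α] [AddGroup τ]
    {φ : Flow τ α} {x : α} {t : τ} : t ∈ φ.periods x ↔ φ t x = x :=
  Iff.rfl

theorem isClosed_periods {τ α : Type*} [TopologicalSpace τ] [TopologicalSpace α] [AddGroup τ]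
    [T2Space α] (φ : Flow τ α) (x : α) : IsClosed (φ.periods x : Set τ) :=
  isClosed_eq (φ.continuous continuous_id continuous_const) continuous_const

theorem eq_of_forall_dyadic {α : Type*} [TopologicalSpace α] [T2Space α] {φ : Flow ℝ α} {x : α}
    (hx : ∀ n : ℕ, φ (1 / 2 ^ n) x = x) (t : ℝ) : φ t x = x := by
  have hd : Dense (φ.periods x : Set ℝ) := by
    refine AddSubgroup.dense_of_not_isolated_zero _ fun ε hε => ?_
    obtain ⟨n, hn⟩ := exists_pow_lt_of_lt_one hε (one_half_lt_one (α := ℝ))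
    exact ⟨1 / 2 ^ n, hx n, by positivity, by simpa using hn⟩
  rw [← mem_periods, ← SetLike.mem_coe, ← (φ.isClosed_periods x).closure_eq]
  exact hd t

end Flow

/-- Let `X` be a nonempty compact Hausdorff topological space and let `φ` be a flow on `X`.
If for every natural number `n` the time-`(1/2^n)` map `x ↦ φ (1/2^n) x` has a fixed point,
then the flow has a stationary point: there exists `x ∈ X` with `φ t x = x` for all `t : ℝ`. -/
theorem stmt0 {X : Type*} [TopologicalSpace X] [Nonempty X] [CompactSpace X] [T2Space X]
    (φ : Flow ℝ X) (h : ∀ n : ℕ, ∃ x : X, φ (1 / 2 ^ n) x = x) :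
    ∃ x : X, ∀ t : ℝ, φ t x = x := by
  obtain ⟨x, hx⟩ := IsCompact.nonempty_iInter_of_sequence_nonempty_isCompact_isClosed
    (fun n : ℕ => {x : X | φ (1 / 2 ^ n) x = x})
    (fun n x (hx : φ (1 / 2 ^ (n + 1)) x = x) => by
      have hadd : (1 / 2 ^ n : ℝ) = 1 / 2 ^ (n + 1) + 1 / 2 ^ (n + 1) := by
        rw [pow_succ]; field_simp; norm_num
      rw [Set.mem_ofPred_eq, hadd, φ.map_add, hx, hx])
    h (isClosed_eq (φ.continuous_toFun _) continuous_id).isCompact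
    fun n => isClosed_eq (φ.continuous_toFun _) continuous_id
  exact ⟨x, Flow.eq_of_forall_dyadic fun n => Set.mem_iInter.mp hx n⟩
end

section
/- Let X be a topological space in which every point has a neighborhood that is second countable as a subspace. Then the following are equivalent: (i) the closure of every countable subset of X is compact (i.e. X is ω-bounded); (ii) every Lindelöf subset of X has compact closure. -/
/-- In a space where every point has a second countable neighborhood, ω-boundedness
(every countable set has compact closure) is equivalent to every Lindelöf subset
having compact closure. -/
theorem stmt4 {X : Type*} [TopologicalSpace X]
    (h : ∀ x : X, ∃ s : Set X, s ∈ nhds x ∧ SecondCountableTopology s) :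
    (∀ s : Set X, s.Countable → IsCompact (closure s)) ↔
    (∀ s : Set X, IsLindelof s → IsCompact (closure s)) := by
  refine ⟨fun hc s hs => ?_, fun hl s hs => hl s hs.isLindelof⟩
  choose t ht ht₂ using h
  obtain ⟨r, hr, -, hsr⟩ := hs.elim_nhds_subcover t fun x _ => ht x
  have hsep : TopologicalSpace.IsSeparable s := by
    have := hr.to_subtype
    rw [Set.biUnion_eq_iUnion] at hsr
    refine TopologicalSpace.IsSeparable.mono (.iUnion fun x => ?_) hsr
    have := ht₂ x
    exact .of_subtype (t x)
  obtain ⟨c, hcount, hsc⟩ := hsep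
  exact (hc c hcount).of_isClosed_subset isClosed_closure (closure_minimal hsc isClosed_closure)
end

section
/- Let X be a topological space in which every Lindelöf subset has compact closure, let φ be a flow on X, and let B ⊆ X be compact. Then the closure of the saturation ℝB := ⋃_{t ∈ ℝ} φ_t(B) is a compact, flow-invariant subset of X. -/
/-- The saturation of a compact set under a real flow is Lindelöf. -/
theorem IsCompact.isLindelof_iUnion_flow_image {X : Type*} [TopologicalSpace X]
    (φ : Flow ℝ X) {B : Set X} (hB : IsCompact B) :
    IsLindelof (⋃ t : ℝ, (fun x => φ t x) '' B) := by
  have h : (⋃ t : ℝ, (fun x => φ t x) '' B) =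
      ⋃ n : ℕ, Function.uncurry φ.toFun '' (Metric.closedBall (0 : ℝ) n ×ˢ B) := by
    rw [← Set.image_iUnion, ← Set.iUnion_prod_const, Metric.iUnion_closedBall_nat,
      Set.image_uncurry_prod, ← Set.iUnion_image_left, Set.biUnion_univ]
  rw [h]
  exact isLindelof_iUnion fun n =>
    (((isCompact_closedBall (0 : ℝ) n).prod hB).image φ.cont').isLindelof


/-- Let `X` be a space in which every Lindelöf subset has compact closure, `φ` a flow on `X`,
and `B ⊆ X` compact. Then the closure of the saturation `ℝB = ⋃ t, φ t '' B` is a compact,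
flow-invariant subset of `X`. -/
theorem stmt10 {X : Type*} [TopologicalSpace X]
    (hX : ∀ s : Set X, IsLindelof s → IsCompact (closure s))
    (φ : Flow ℝ X) (B : Set X) (hB : IsCompact B) :
    IsCompact (closure (⋃ t : ℝ, (fun x => φ t x) '' B)) ∧
    ∀ t : ℝ, (fun x => φ t x) '' closure (⋃ t : ℝ, (fun x => φ t x) '' B) ⊆
      closure (⋃ t : ℝ, (fun x => φ t x) '' B) := by
  refine ⟨hX _ (hB.isLindelof_iUnion_flow_image φ), fun t => ?_⟩
  refine (image_closure_subset_closure_image (φ.continuous continuous_const continuous_id)).trans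
    (closure_mono ?_)
  rintro _ ⟨_, hy, rfl⟩
  obtain ⟨s, x, hx, rfl⟩ := Set.mem_iUnion.1 hy
  exact Set.mem_iUnion.2 ⟨t + s, x, hx, φ.map_add t s x⟩
end
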